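/- For every ε > 0 there exist C > 0 and n₀ such that for all n ≥ n₀, all positive integers m, and every matrix A ∈ ℝ^{m×n} with ‖A‖_{1→∞} ≤ 1, one has OPT_A(C) ≥ √(2n/π) − ε·√n. -/

import Mathlib

open MeasureTheory ProbabilityTheory

/-- `Γ_{A,C} = {x : ‖x‖_∞ ≤ 1 ∧ ‖Ax‖_∞ ≤ C √(n log(m/n + 2))}`. -/
def Gamma (m n : ℕ) (A : Matrix (Fin m) (Fin n) ℝ) (C : ℝ) : Set (Fin n → ℝ) :=
  {x | (∀ j, |x j| ≤ 1) ∧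
    ∀ i, |A.mulVec x i| ≤ C * Real.sqrt ((n : ℝ) * Real.log ((m : ℝ) / (n : ℝ) + 2))}

/-- `OPT_A(C) = E_{g ~ N(0,Iₙ)}[sup_{y ∈ Γ_{A,C}} ⟨g,y⟩] / √n`. -/
noncomputable def OPT (m n : ℕ) (A : Matrix (Fin m) (Fin n) ℝ) (C : ℝ) : ℝ :=
  (∫ g, sSup {t | ∃ y ∈ Gamma m n A C, t = ∑ j, g j * y j}
    ∂(Measure.pi fun _ : Fin n => gaussianReal 0 1)) / Real.sqrt n

lemma num_step (κ β p q : ℝ) (hκ : κ ≤ 1) (hβ : 0 < β) (hp : 0 < p) (hq : 0 ≤ q) (hqp : q ≤ p)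
    (w B wt wf : ℝ) (h1 : wt ≤ w) (ht : B + β⁻¹ * Real.log p ≤ wt)
    (hf : 0 < q → B + β⁻¹ * Real.log q ≤ wf)
    (h2 : 0 < q → κ + (wt + wf) / 2 ≤ w) :
    B + κ - β - β⁻¹ * Real.log 2 + β⁻¹ * Real.log (p + q) ≤ w := by
  have hβi : β⁻¹ * β = 1 := by field_simp
  have hβi0 : 0 < β⁻¹ := by positivity
  by_cases hc : q ≤ p * Real.exp (-(2 * β))
  · have hlog : Real.log (p + q) ≤ Real.log p + Real.log 2 - β + β ^ 2 / 2 := by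
      have : p + q ≤ p * 2 * Real.exp (-β) * Real.exp (β ^ 2 / 2) := by
        have := Real.cosh_le_exp_half_sq β
        have e1 : p + q ≤ p * 2 * Real.exp (-β) * Real.cosh β := by
          rw [Real.cosh_eq]
          have e3 : Real.exp (-(2 * β)) = Real.exp (-β) * Real.exp (-β) := by
            rw [← Real.exp_add]; ring_nf
          have e2 : Real.exp (-β) * Real.exp β = 1 := by rw [← Real.exp_add]; simp
          rw [e3] at hc
          have : p * 2 * Real.exp (-β) * ((Real.exp β + Real.exp (-β)) / 2)
            = p * (Real.exp (-β) * Real.exp β) + p * (Real.exp (-β) * Real.exp (-β)) := by ring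
          rw [this, e2]; linarith
        refine e1.trans ?_
        gcongr
      have h := Real.log_le_log (by positivity) this
      rw [Real.log_mul (by positivity) (by positivity), Real.log_mul (by positivity) (by positivity),
        Real.log_mul (by positivity) (by positivity), Real.log_exp, Real.log_exp] at h
      linarith
    have := mul_le_mul_of_nonneg_left hlog hβi0.le
    have e : β⁻¹ * (Real.log p + Real.log 2 - β + β ^ 2 / 2) =
      β⁻¹ * Real.log p + β⁻¹ * Real.log 2 - (β⁻¹ * β) + (β⁻¹ * β) * β / 2 := by ring
    rw [e, hβi] at this
    linarith
  · push Not at hc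
    have hq0 : 0 < q := lt_of_le_of_lt (by positivity) hc
    have hl1 : Real.log p - 2 * β ≤ Real.log q := by
      have := Real.log_le_log (by positivity) hc.le
      rw [Real.log_mul (by positivity) (by positivity), Real.log_exp] at this
      linarith
    have hl2 := Real.log_le_log hq0 hqp
    set s := (Real.log p - Real.log q) / 2 with hs
    have hs0 : 0 ≤ s := by linarith
    have hs1 : s ≤ β := by linarith
    have hlog : Real.log (p + q) ≤ (Real.log p + Real.log q) / 2 + Real.log 2 + s ^ 2 / 2 := by
      set u := (Real.log p + Real.log q) / 2 with hu
      have ep : p = Real.exp (u + s) := by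
        rw [hu, hs]; ring_nf; rw [Real.exp_log hp]
      have eq : q = Real.exp (u - s) := by
        rw [hu, hs]; ring_nf; rw [Real.exp_log hq0]
      have : p + q ≤ Real.exp u * 2 * Real.exp (s ^ 2 / 2) := by
        have h := Real.cosh_le_exp_half_sq s
        have : p + q = Real.exp u * 2 * Real.cosh s := by
          rw [Real.cosh_eq, ep, eq, sub_eq_add_neg, Real.exp_add, Real.exp_add]; ring
        rw [this]; gcongr
      have h := Real.log_le_log (by positivity) this
      rw [Real.log_mul (by positivity) (by positivity), Real.log_mul (by positivity) (by positivity),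
         Real.log_exp, Real.log_exp] at h
      linarith
    have := mul_le_mul_of_nonneg_left hlog hβi0.le
    have hs2 : β⁻¹ * (s ^ 2 / 2) ≤ β := by
      have : s ^ 2 ≤ β ^ 2 := by gcongr
      calc β⁻¹ * (s ^ 2 / 2) ≤ β⁻¹ * (2 * β ^ 2 / 2) := by gcongr; nlinarith
        _ = β⁻¹ * β * β := by ring
        _ = β := by rw [hβi, one_mul]
    have := hf hq0
    have := h2 hq0
    have e : β⁻¹ * ((Real.log p + Real.log q) / 2 + Real.log 2 + s ^ 2 / 2) =
      (β⁻¹ * Real.log p + β⁻¹ * Real.log q) / 2 + β⁻¹ * Real.log 2 + β⁻¹ * (s ^ 2 / 2) := by ring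
    linarith

lemma gauss_abs : ∫ x, |x| ∂(gaussianReal 0 1) = Real.sqrt (2 / Real.pi) := by
  rw [integral_gaussianReal_eq_integral_smul (by norm_num)]
  have h1 : ∀ x : ℝ, gaussianPDFReal 0 1 x • |x| =
      (fun y => (Real.sqrt (2 * Real.pi))⁻¹ * (y ^ (1:ℝ) * Real.exp (-(1/2) * y ^ (2:ℝ)))) |x| := by
    intro x
    simp [gaussianPDFReal, smul_eq_mul]
    ring_nf
  rw [integral_congr_ae (Filter.Eventually.of_forall h1)]
  rw [integral_comp_abs (f := fun y => (Real.sqrt (2 * Real.pi))⁻¹ * (y ^ (1:ℝ) * Real.exp (-(1/2) * y ^ (2:ℝ)))), integral_const_mul, integral_rpow_mul_exp_neg_mul_rpow (by norm_num) (by norm_num) (by norm_num)]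
  norm_num
  have : Real.sqrt 2 * Real.sqrt 2 = 2 := Real.mul_self_sqrt (by norm_num)
  have : 0 < Real.sqrt Real.pi := Real.sqrt_pos.2 Real.pi_pos
  field_simp
  nlinarith

noncomputable def FF {n : ℕ} (K : Set (Fin n → ℝ)) (g : Fin n → ℝ) : ℝ :=
  sSup {t | ∃ y ∈ K, t = ∑ j, g j * y j}

def InCube {n : ℕ} (K : Set (Fin n → ℝ)) : Prop := ∀ y ∈ K, ∀ j, |y j| ≤ 1

lemma lin_le {n : ℕ} {y : Fin n → ℝ} (hy : ∀ j, |y j| ≤ 1) (g : Fin n → ℝ) :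
    |∑ j, g j * y j| ≤ ∑ j, |g j| := by
  refine (Finset.abs_sum_le_sum_abs _ _).trans (Finset.sum_le_sum fun j _ => ?_)
  rw [abs_mul]
  exact mul_le_of_le_one_right (abs_nonneg _) (hy j)

lemma le_FF {n : ℕ} {K : Set (Fin n → ℝ)} (hK : InCube K) {y : Fin n → ℝ} (hy : y ∈ K)
    (g : Fin n → ℝ) : ∑ j, g j * y j ≤ FF K g := by
  refine le_csSup ⟨∑ j, |g j|, ?_⟩ ⟨y, hy, rfl⟩
  rintro t ⟨z, hz, rfl⟩
  exact (le_abs_self _).trans (lin_le (hK z hz) g)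

lemma FF_le {n : ℕ} {K : Set (Fin n → ℝ)} (hne : K.Nonempty) {g : Fin n → ℝ} {c : ℝ}
    (h : ∀ y ∈ K, ∑ j, g j * y j ≤ c) : FF K g ≤ c := by
  refine csSup_le ?_ ?_
  · obtain ⟨y, hy⟩ := hne
    exact ⟨_, y, hy, rfl⟩
  · rintro t ⟨z, hz, rfl⟩
    exact h z hz

lemma FF_abs {n : ℕ} {K : Set (Fin n → ℝ)} (hK : InCube K) (hne : K.Nonempty) (g : Fin n → ℝ) :
    |FF K g| ≤ ∑ j, |g j| := by
  rw [abs_le]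
  constructor
  · obtain ⟨y, hy⟩ := hne
    exact (abs_le.1 (lin_le (hK y hy) g)).1.trans (le_FF hK hy g)
  · exact FF_le hne fun y hy => (abs_le.1 (lin_le (hK y hy) g)).2

lemma FF_cont {n : ℕ} {K : Set (Fin n → ℝ)} (hK : InCube K) (hne : K.Nonempty) :
    Continuous (FF K) := by
  refine (LipschitzWith.of_le_add_mul (n : NNReal) fun g g' => ?_).continuous
  refine FF_le hne fun y hy => ?_
  have h1 := le_FF hK hy g'
  have h2 : ∑ j, g j * y j - ∑ j, g' j * y j ≤ n * dist g g' := by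
    rw [← Finset.sum_sub_distrib]
    calc ∑ j, (g j * y j - g' j * y j) ≤ ∑ j : Fin n, dist g g' := by
          refine Finset.sum_le_sum fun j _ => ?_
          rw [← sub_mul]
          refine (le_abs_self _).trans ?_
          rw [abs_mul]
          refine (mul_le_of_le_one_right (abs_nonneg _) (hK y hy j)).trans ?_
          exact dist_le_pi_dist g g' j
      _ = _ := by simp
  simp only [NNReal.coe_natCast]
  linarith

noncomputable abbrev γ (n : ℕ) : Measure (Fin n → ℝ) := Measure.pi fun _ : Fin n => gaussianReal 0 1

lemma abs_int : Integrable (fun x : ℝ => |x|) (gaussianReal 0 1) := by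
  have := (memLp_id_gaussianReal (μ := 0) (v := 1) 1).integrable (by simp)
  exact this.abs

lemma FF_int {n : ℕ} {K : Set (Fin n → ℝ)} (hK : InCube K) (hne : K.Nonempty) :
    Integrable (FF K) (γ n) := by
  have : Integrable (fun g : Fin n → ℝ => ∑ j, |g j|) (γ n) := by
    refine integrable_finsetSum _ fun j _ => ?_
    exact integrable_comp_eval (μ := fun _ : Fin n => gaussianReal 0 1) (i := j) abs_int
  exact this.mono' (FF_cont hK hne).aestronglyMeasurable
    (Filter.Eventually.of_forall fun g => FF_abs hK hne g)

lemma neg_inv1 (h : ℝ → ℝ) : ∫ x, h (-x) ∂(gaussianReal 0 1) = ∫ x, h x ∂(gaussianReal 0 1) := by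
  have e : (gaussianReal 0 1).map (MeasurableEquiv.neg ℝ) = gaussianReal 0 1 := by
    have := gaussianReal_map_neg (μ := 0) (v := 1)
    simpa using this
  conv_rhs => rw [← e]
  rw [integral_map_equiv]
  rfl

lemma neg_mp (n : ℕ) : MeasurePreserving (fun g : Fin n → ℝ => fun j => - g j) (γ n) (γ n) := by
  refine measurePreserving_pi (fun _ => gaussianReal 0 1) (fun _ => gaussianReal 0 1) (f := fun _ x => -x) fun i => ⟨measurable_neg, ?_⟩
  have := gaussianReal_map_neg (μ := 0) (v := 1)
  simpa using this

lemma neg_invn {n : ℕ} (h : (Fin n → ℝ) → ℝ) : ∫ g, h (-g) ∂(γ n) = ∫ g, h g ∂(γ n) := by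
  have := (neg_mp n).integral_comp (MeasurableEquiv.neg (Fin n → ℝ)).measurableEmbedding h
  exact this

lemma int_succ {n : ℕ} {K : Set (Fin (n+1) → ℝ)} (hK : InCube K) (hne : K.Nonempty) :
    Integrable (fun x => ∫ g, FF K (Fin.cons x g) ∂(γ n)) (gaussianReal 0 1) ∧
    (∀ᵐ x ∂(gaussianReal 0 1), Integrable (fun g => FF K (Fin.cons x g)) (γ n)) ∧ 
    ∫ g, FF K g ∂(γ (n+1)) = ∫ x, ∫ g, FF K (Fin.cons x g) ∂(γ n) ∂(gaussianReal 0 1) := by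
  have mp := (measurePreserving_piFinSuccAbove (fun _ : Fin (n+1) => gaussianReal 0 1) 0).symm
  have hi : Integrable (fun p : ℝ × (Fin n → ℝ) => FF K (Fin.cons p.1 p.2)) ((gaussianReal 0 1).prod (γ n)) := by
    have := mp.integrable_comp_of_integrable (FF_int hK hne)
    simpa [Function.comp_def, MeasurableEquiv.piFinSuccAbove, Fin.insertNthEquiv] using this
  refine ⟨hi.integral_prod_left, hi.prod_right_ae, ?_⟩
  rw [← integral_prod _ hi]
  have := mp.integral_comp (MeasurableEquiv.measurableEmbedding _) (FF K)
  rw [← this]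
  simp [MeasurableEquiv.piFinSuccAbove, Fin.insertNthEquiv]

def sg (b : Bool) : ℝ := if b then 1 else -1

lemma sg_abs (b : Bool) : |sg b| ≤ 1 := by cases b <;> simp [sg]

def KS {n : ℕ} (S : Finset (Fin n → Bool)) : Set (Fin n → ℝ) :=
  {y | ∃ z ∈ S, y = fun j => sg (z j)}

lemma KS_cube {n : ℕ} (S : Finset (Fin n → Bool)) : InCube (KS S) := by
  rintro y ⟨z, _, rfl⟩ j
  exact sg_abs _

lemma KS_ne {n : ℕ} {S : Finset (Fin n → Bool)} (h : S.Nonempty) : (KS S).Nonempty := by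
  obtain ⟨z, hz⟩ := h
  exact ⟨_, z, hz, rfl⟩

def slice {n : ℕ} (S : Finset (Fin (n+1) → Bool)) (b : Bool) : Finset (Fin n → Bool) :=
  Finset.univ.filter fun z => (Fin.cons b z : Fin (n+1) → Bool) ∈ S

lemma slice_card {n : ℕ} (S : Finset (Fin (n+1) → Bool)) :
    S.card = (slice S true).card + (slice S false).card := by
  have h1 : S.card = ∑ z : Fin (n+1) → Bool, if z ∈ S then 1 else 0 := by simp
  rw [h1, ← (Fin.consEquiv (fun _ => Bool)).sum_comp, Fintype.sum_prod_type, Fintype.sum_bool]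
  simp only [slice, Finset.card_filter]
  rfl

lemma slice_pt {n : ℕ} {S : Finset (Fin (n+1) → Bool)} {b : Bool} (h : (slice S b).Nonempty)
    (x : ℝ) (g : Fin n → ℝ) :
    sg b * x + FF (KS (slice S b)) g ≤ FF (KS S) (Fin.cons x g) := by
  have : FF (KS (slice S b)) g ≤ FF (KS S) (Fin.cons x g) - sg b * x := by
    refine FF_le (KS_ne h) ?_
    rintro y ⟨z, hz, rfl⟩
    have hz' : (Fin.cons b z : Fin (n+1) → Bool) ∈ S := by simpa [slice] using hz
    have := le_FF (KS_cube S) (y := fun j => sg ((Fin.cons b z : Fin (n+1) → Bool) j))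
      ⟨_, hz', rfl⟩ (Fin.cons x g)
    rw [Fin.sum_univ_succ] at this
    simp only [Fin.cons_zero, Fin.cons_succ] at this
    linarith
  linarith

noncomputable def wS {n : ℕ} (S : Finset (Fin n → Bool)) : ℝ := ∫ g, FF (KS S) g ∂(γ n)

lemma slice_ne {n : ℕ} {S : Finset (Fin (n+1) → Bool)} {b : Bool} (h : (slice S b).Nonempty) :
    S.Nonempty := by
  obtain ⟨z, hz⟩ := h
  exact ⟨_, by simpa [slice] using hz⟩

lemma slice_ae {n : ℕ} {S : Finset (Fin (n+1) → Bool)} {b : Bool} (h : (slice S b).Nonempty) :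
    ∀ᵐ x ∂(gaussianReal 0 1), sg b * x + wS (slice S b) ≤ ∫ g, FF (KS S) (Fin.cons x g) ∂(γ n) := by
  obtain ⟨-, h2, -⟩ := int_succ (KS_cube S) (KS_ne (slice_ne h))
  filter_upwards [h2] with x hx
  have hi := FF_int (KS_cube (slice S b)) (KS_ne h)
  have : ∫ g, (sg b * x + FF (KS (slice S b)) g) ∂(γ n) = sg b * x + wS (slice S b) := by
    rw [integral_add (integrable_const _) hi]
    simp [wS]
  rw [← this]
  exact integral_mono ((integrable_const _).add hi) hx fun g => slice_pt h x g

lemma id_int : Integrable (fun x : ℝ => x) (gaussianReal 0 1) :=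
  (memLp_id_gaussianReal (μ := 0) (v := 1) 1).integrable (by simp)

lemma slice_one {n : ℕ} {S : Finset (Fin (n+1) → Bool)} {b : Bool} (h : (slice S b).Nonempty) :
    wS (slice S b) ≤ wS S := by
  obtain ⟨h1, h2, h3⟩ := int_succ (KS_cube S) (KS_ne (slice_ne h))
  have := integral_mono_ae ((id_int.const_mul (sg b)).add (integrable_const (wS (slice S b)))) h1 (slice_ae h)
  simp only [Pi.add_apply] at this
  rw [integral_add (id_int.const_mul (sg b)) (integrable_const _), integral_const_mul, integral_id_gaussianReal] at this
  have e : wS S = _ := h3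
  rw [e]
  simpa using this

lemma slice_two {n : ℕ} {S : Finset (Fin (n+1) → Bool)} (ht : (slice S true).Nonempty)
    (hf : (slice S false).Nonempty) :
    Real.sqrt (2 / Real.pi) + (wS (slice S true) + wS (slice S false)) / 2 ≤ wS S := by
  obtain ⟨h1, h2, h3⟩ := int_succ (KS_cube S) (KS_ne (slice_ne ht))
  set H : ℝ → ℝ := fun x => ∫ g, FF (KS S) (Fin.cons x g) ∂(γ n) with hH
  have hmp : MeasurePreserving (fun x : ℝ => -x) (gaussianReal 0 1) (gaussianReal 0 1) :=
    ⟨measurable_neg, by simpa using gaussianReal_map_neg (μ := 0) (v := 1)⟩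
  have h1' : Integrable (fun x => H (-x)) (gaussianReal 0 1) := hmp.integrable_comp_of_integrable h1
  have at1 := slice_ae ht
  have af1 := slice_ae hf
  have at2 := hmp.quasiMeasurePreserving.ae at1
  have af2 := hmp.quasiMeasurePreserving.ae af1
  have key : ∀ᵐ x ∂(gaussianReal 0 1), 2 * |x| + (wS (slice S true) + wS (slice S false)) ≤ H x + H (-x) := by
    filter_upwards [at1, af1, at2, af2] with x a b c d
    simp only [sg, if_true, Bool.false_eq_true, if_false] at a b c d
    simp only [hH]
    rcases abs_cases x with ⟨e, _⟩ | ⟨e, _⟩ <;> rw [e] <;> linarith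
  have := integral_mono_ae ((abs_int.const_mul 2).add (integrable_const (wS (slice S true) + wS (slice S false)))) (h1.add h1') key
  simp only [Pi.add_apply] at this
  rw [integral_add (abs_int.const_mul 2) (integrable_const _), integral_const_mul, gauss_abs,
    integral_add h1 h1', neg_inv1 H, ← h3] at this
  simp only [integral_const, probReal_univ, one_smul] at this
  have e : wS S = ∫ g, FF (KS S) g ∂(γ (n+1)) := rfl
  linarith

lemma width {β : ℝ} (hβ : 0 < β) : ∀ (n : ℕ) (S : Finset (Fin n → Bool)), S.Nonempty →
    n * (Real.sqrt (2 / Real.pi) - β) - β⁻¹ * (n * Real.log 2) + β⁻¹ * Real.log S.card ≤ wS S := by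
  intro n
  have hκ : Real.sqrt (2 / Real.pi) ≤ 1 := by
    rw [Real.sqrt_le_left (by norm_num), one_pow, div_le_one Real.pi_pos]
    exact Real.two_le_pi
  induction n with
  | zero =>
    intro S hS
    have hc : S.card = 1 := by
      have h1 : S.card ≤ 1 := by
        have := Finset.card_le_univ S
        simpa using this
      have := hS.card_pos
      omega
    have : wS S = 0 := by
      have : ∀ g, FF (KS S) g = 0 := fun g => by
        have := FF_abs (KS_cube S) (KS_ne hS) g
        simpa using this
      simp [wS, this]
    simp [this, hc]
  | succ n ih =>
    intro S hS
    have main : ∀ b : Bool, (slice S (!b)).card ≤ (slice S b).card → 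
      (n + 1 : ℕ) * (Real.sqrt (2 / Real.pi) - β) - β⁻¹ * ((n + 1 : ℕ) * Real.log 2) + β⁻¹ * Real.log S.card ≤ wS S := by
      intro b hb
      have hc : S.card = (slice S b).card + (slice S (!b)).card := by
        rw [slice_card]; cases b
        · simp [add_comm]
        · simp
      have hpos : 0 < (slice S b).card := by
        have := hS.card_pos
        omega
      have hne := Finset.card_pos.1 hpos
      have := num_step (Real.sqrt (2 / Real.pi)) β (slice S b).card (slice S (!b)).card hκ hβ
        (by exact_mod_cast hpos) (by positivity) (by exact_mod_cast hb) (wS S)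
        (n * (Real.sqrt (2 / Real.pi) - β) - β⁻¹ * (n * Real.log 2)) (wS (slice S b)) (wS (slice S (!b)))
        (slice_one hne) (ih _ hne) (fun h => ih _ (Finset.card_pos.1 (by exact_mod_cast h)))
        (fun h => by
          have h' := Finset.card_pos.1 (Nat.cast_pos.1 h)
          cases b
          · have := slice_two h' hne
            simp only [Bool.not_false]; linarith
          · have := slice_two hne h'
            simp only [Bool.not_true]; linarith)
      rw [hc]
      push_cast
      linarith
    rcases le_total (slice S true).card (slice S false).card with h | h
    · exact main false h
    · exact main true h

lemma mgf {n : ℕ} (a : Fin n → ℝ) (ha : ∀ j, |a j| ≤ 1) (l : ℝ) :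
    ∑ z : Fin n → Bool, Real.exp (l * ∑ j, a j * sg (z j)) ≤ 2 ^ n * Real.exp (l ^ 2 * n / 2) := by
  have h1 : ∀ z : Fin n → Bool, Real.exp (l * ∑ j, a j * sg (z j)) =
      ∏ j, Real.exp (l * (a j * sg (z j))) := fun z => by
    rw [Finset.mul_sum, Real.exp_sum]
  simp_rw [h1]
  have h2 := Finset.prod_univ_sum (fun _ : Fin n => (Finset.univ : Finset Bool))
    (fun j b => Real.exp (l * (a j * sg b)))
  rw [Fintype.piFinset_univ] at h2
  rw [← h2]
  have h3 : ∀ j, ∑ b : Bool, Real.exp (l * (a j * sg b)) ≤ 2 * Real.exp (l ^ 2 / 2) := fun j => by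
    rw [Fintype.sum_bool]
    have := Real.cosh_le_exp_half_sq (l * a j)
    rw [Real.cosh_eq] at this
    have h4 : Real.exp ((l * a j) ^ 2 / 2) ≤ Real.exp (l ^ 2 / 2) := by
      have : (a j) ^ 2 ≤ 1 := by
        rw [← sq_abs]; exact pow_le_one₀ (abs_nonneg _) (ha j)
      rw [mul_pow]
      gcongr
      nlinarith [sq_nonneg l]
    simp only [sg, if_true, Bool.false_eq_true, if_false, mul_one, mul_neg]
    linarith
  calc _ ≤ ∏ j : Fin n, (2 * Real.exp (l ^ 2 / 2)) :=
        Finset.prod_le_prod (fun j _ => by positivity) fun j _ => h3 j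
    _ = _ := by
      rw [Finset.prod_const, Finset.card_univ, Fintype.card_fin, mul_pow, ← Real.exp_nat_mul]
      ring_nf

lemma mgf_abs {n : ℕ} (a : Fin n → ℝ) (ha : ∀ j, |a j| ≤ 1) (l : ℝ) :
    ∑ z : Fin n → Bool, Real.exp (l * |∑ j, a j * sg (z j)|) ≤
      2 * (2 ^ n * Real.exp (l ^ 2 * n / 2)) := by
  have h1 := mgf a ha l
  have h2 := mgf a ha (-l)
  rw [neg_sq] at h2
  calc _ ≤ ∑ z : Fin n → Bool, (Real.exp (l * ∑ j, a j * sg (z j)) +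
          Real.exp (-l * ∑ j, a j * sg (z j))) := by
        refine Finset.sum_le_sum fun z _ => ?_
        rcases abs_cases (∑ j, a j * sg (z j)) with ⟨e, _⟩ | ⟨e, _⟩ <;> rw [e]
        · have := Real.exp_pos (-l * ∑ j, a j * sg (z j)); linarith
        · have := Real.exp_pos (l * ∑ j, a j * sg (z j))
          rw [mul_neg, ← neg_mul]; linarith
    _ ≤ _ := by rw [Finset.sum_add_distrib]; linarith

lemma round_bd {q : ℝ} (hq : 1 ≤ q) (t : ℝ) : |((round t : ℤ) : ℝ)| ≤ Real.exp (q * (2 * |t| - 1)) := by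
  have h0 := abs_sub_round t
  have h1 : |((round t : ℤ) : ℝ)| ≤ |t| + 1 / 2 := by
    have := abs_sub_abs_le_abs_sub ((round t : ℤ) : ℝ) t
    rw [abs_sub_comm] at this
    linarith
  by_cases h : |t| < 1 / 2
  · have : round t = 0 := by
      have h2 : |((round t : ℤ) : ℝ)| < 1 := by linarith
      have h3 : |round t| < 1 := by exact_mod_cast h2
      exact Int.abs_lt_one_iff.1 h3
    rw [this]
    simp [Real.exp_nonneg]
  · push Not at h
    have h2 := Real.add_one_le_exp (2 * |t| - 1)
    have h3 : Real.exp (2 * |t| - 1) ≤ Real.exp (q * (2 * |t| - 1)) := by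
      apply Real.exp_le_exp.2
      nlinarith
    linarith

lemma avg_bd {n : ℕ} (hn : 0 < n) (a : Fin n → ℝ) (ha : ∀ j, |a j| ≤ 1) {C L : ℝ} (hC : 0 < C)
    (hL : 0 < L) (hCL : 4 ≤ C ^ 2 * L) :
    ∑ z : Fin n → Bool, |((round ((∑ j, a j * sg (z j)) / (C * Real.sqrt (n * L))) : ℤ) : ℝ)| ≤
      2 ^ n * (2 * Real.exp (- (C ^ 2 * L / 8))) := by
  have hn' : (0 : ℝ) < n := by exact_mod_cast hn
  set T := C * Real.sqrt (n * L) with hT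
  have hT0 : 0 < T := by positivity
  have hT2 : T ^ 2 = C ^ 2 * (n * L) := by rw [hT, mul_pow, Real.sq_sqrt (by positivity)]
  set q := C ^ 2 * L / 4 with hq
  have hq1 : 1 ≤ q := by linarith
  have hm := mgf_abs a ha (2 * q / T)
  calc _ ≤ ∑ z : Fin n → Bool, Real.exp (-q) * Real.exp (2 * q / T * |∑ j, a j * sg (z j)|) := by
        refine Finset.sum_le_sum fun z _ => (round_bd hq1 _).trans (le_of_eq ?_)
        rw [← Real.exp_add, abs_div, abs_of_pos hT0]
        congr 1
        ring
    _ = Real.exp (-q) * ∑ z : Fin n → Bool, Real.exp (2 * q / T * |∑ j, a j * sg (z j)|) := by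
        rw [Finset.mul_sum]
    _ ≤ Real.exp (-q) * (2 * (2 ^ n * Real.exp ((2 * q / T) ^ 2 * n / 2))) := by gcongr
    _ = 2 ^ n * (2 * (Real.exp (-q) * Real.exp ((2 * q / T) ^ 2 * n / 2))) := by ring
    _ = _ := by
        rw [← Real.exp_add]
        congr 3
        rw [div_pow, hT2, hq]
        field_simp
        ring

lemma geo {s : ℝ} (hs : Real.exp (-s) ≤ 1 / 2) (U : Finset ℤ) :
    ∑ k ∈ U, Real.exp (-s * |(k : ℝ)|) ≤ 1 + 4 * Real.exp (-s) := by
  set r := Real.exp (-s) with hr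
  have hr0 : 0 < r := Real.exp_pos _
  have g := hasSum_geometric_of_lt_one hr0.le (by linarith)
  have h1 : HasSum (fun n : ℕ => Real.exp (-s * |((n : ℤ) : ℝ)|)) (1 - r)⁻¹ := by
    convert g using 2 with n
    rw [hr, ← Real.exp_nat_mul]
    simp [mul_comm]
  have h2 : HasSum (fun n : ℕ => Real.exp (-s * |((-((n : ℤ) + 1) : ℤ) : ℝ)|)) (r * (1 - r)⁻¹) := by
    have e : (fun n : ℕ => Real.exp (-s * |((-((n : ℤ) + 1) : ℤ) : ℝ)|)) = fun n => r * r ^ n := by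
      funext n
      rw [hr, ← Real.exp_nat_mul, ← Real.exp_add]
      push_cast
      rw [abs_neg, abs_of_nonneg (by positivity)]
      ring_nf
    rw [e]
    exact g.mul_left r
  have h3 := HasSum.of_nat_of_neg_add_one (f := fun k : ℤ => Real.exp (-s * |(k : ℝ)|)) h1 h2
  refine (sum_le_hasSum U (fun _ _ => by positivity) h3).trans ?_
  have : 0 < 1 - r := by linarith
  have e : (1 - r)⁻¹ + r * (1 - r)⁻¹ = (1 + r) / (1 - r) := by field_simp
  rw [e, div_le_iff₀ this]
  nlinarith

lemma cell {X : Type*} [Fintype X] [Nonempty X] {m : ℕ} (b : X → Fin m → ℤ) {s : ℝ}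
    (hs : Real.exp (-s) ≤ 1 / 2) :
    ∃ v : Fin m → ℤ, (Finset.univ.filter fun x => b x = v).Nonempty ∧
      Real.log (Fintype.card X) - s * (∑ x, ∑ i, |(b x i : ℝ)|) / Fintype.card X -
        4 * m * Real.exp (-s) ≤ Real.log ((Finset.univ.filter fun x => b x = v).card) := by
  classical
  set N : ℝ := (Fintype.card X : ℝ) with hN
  have hN0 : 0 < N := by rw [hN]; exact_mod_cast Fintype.card_pos
  set V := Finset.univ.image b with hV
  obtain ⟨v, hv, hmax⟩ := Finset.exists_max_image V (fun v => (Finset.univ.filter fun x => b x = v).card)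
    (Finset.univ_nonempty.image b)
  have hne : (Finset.univ.filter fun x => b x = v).Nonempty := by
    obtain ⟨x, _, hx⟩ := Finset.mem_image.1 hv
    exact ⟨x, by simpa using hx⟩
  refine ⟨v, hne, ?_⟩
  set k : ℝ := ((Finset.univ.filter fun x => b x = v).card : ℝ) with hk
  have hk0 : 0 < k := by rw [hk]; exact_mod_cast hne.card_pos
  set Q : (Fin m → ℤ) → ℝ := fun v => ∏ i, Real.exp (-s * |(v i : ℝ)|) with hQ
  have hQ0 : ∀ v, 0 ≤ Q v := fun v => Finset.prod_nonneg fun i _ => (Real.exp_pos _).le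
  -- upper bound
  have up : ∑ x, Q (b x) ≤ k * Real.exp (4 * m * Real.exp (-s)) := by
    have e1 : ∑ x, Q (b x) = ∑ w ∈ V, ((Finset.univ.filter fun x => b x = w).card : ℝ) * Q w := by
      rw [← Finset.sum_fiberwise_of_maps_to (s := Finset.univ) (t := V) (g := b)
        (fun x _ => Finset.mem_image_of_mem b (Finset.mem_univ x))]
      refine Finset.sum_congr rfl fun w _ => ?_
      rw [Finset.sum_congr rfl (g := fun _ => Q w), Finset.sum_const, nsmul_eq_mul]
      intro x hx
      rw [(Finset.mem_filter.1 hx).2]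
    have e2 : ∑ w ∈ V, Q w ≤ Real.exp (4 * m * Real.exp (-s)) := by
      set U : Fin m → Finset ℤ := fun i => V.image fun w => w i
      have hsub : V ⊆ Fintype.piFinset U := fun w hw => by
        rw [Fintype.mem_piFinset]
        exact fun i => Finset.mem_image_of_mem _ hw
      refine (Finset.sum_le_sum_of_subset_of_nonneg hsub fun w _ _ => hQ0 w).trans ?_
      rw [hQ, ← Finset.prod_univ_sum U (fun _ k => Real.exp (-s * |(k : ℝ)|))]
      calc _ ≤ ∏ i : Fin m, Real.exp (4 * Real.exp (-s)) := by
            refine Finset.prod_le_prod (fun i _ => Finset.sum_nonneg fun _ _ => (Real.exp_pos _).le)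
              fun i _ => (geo hs (U i)).trans ?_
            have := Real.add_one_le_exp (4 * Real.exp (-s))
            linarith
        _ = _ := by
            rw [Finset.prod_const, Finset.card_univ, Fintype.card_fin, ← Real.exp_nat_mul]
            ring_nf
    rw [e1]
    calc _ ≤ ∑ w ∈ V, k * Q w := by
          refine Finset.sum_le_sum fun w hw => mul_le_mul_of_nonneg_right ?_ (hQ0 w)
          rw [hk]; exact_mod_cast hmax w hw
      _ = k * ∑ w ∈ V, Q w := by rw [Finset.mul_sum]
      _ ≤ _ := by gcongr
  -- lower bound by tangent line
  set D := s * (∑ x, ∑ i, |(b x i : ℝ)|) / N with hD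
  have lo : N * Real.exp (-D) ≤ ∑ x, Q (b x) := by
    have e : ∀ x, Real.exp (-D) * (1 + (-s * (∑ i, |(b x i : ℝ)|) + D)) ≤ Q (b x) := fun x => by
      have : Q (b x) = Real.exp (-D) * Real.exp (-s * (∑ i, |(b x i : ℝ)|) + D) := by
        simp only [hQ]
        rw [← Real.exp_add, ← Real.exp_sum, ← Finset.mul_sum]
        ring_nf
      rw [this]
      gcongr
      have := Real.add_one_le_exp (-s * (∑ i, |(b x i : ℝ)|) + D)
      linarith
    refine le_trans (le_of_eq ?_) (Finset.sum_le_sum fun x _ => e x)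
    rw [← Finset.mul_sum, Finset.sum_add_distrib, Finset.sum_add_distrib, ← Finset.mul_sum]
    simp only [Finset.sum_const, Finset.card_univ, nsmul_eq_mul, ← hN]
    rw [hD]
    field_simp
    ring
  have := Real.log_le_log (by positivity) (lo.trans up)
  rw [Real.log_mul (by positivity) (by positivity), Real.log_mul (by positivity) (by positivity),
    Real.log_exp, Real.log_exp] at this
  linarith

lemma exp_small {K η x : ℝ} (hK : 0 < K) (hη : 0 < η) (hx : K / η ≤ x) : K * Real.exp (-x) ≤ η := by
  have h1 := Real.add_one_le_exp x
  rw [Real.exp_neg, ← div_eq_mul_inv, div_le_iff₀ (Real.exp_pos x)]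
  rw [div_le_iff₀ hη] at hx
  nlinarith

lemma Gamma_ge {m n : ℕ} (A : Matrix (Fin m) (Fin n) ℝ) {C : ℝ} 
    {S : Finset (Fin n → Bool)} (hS : S.Nonempty)
    (h : ∀ z ∈ S, ∀ z' ∈ S, ∀ i, |(∑ j, A i j * sg (z j)) - ∑ j, A i j * sg (z' j)| ≤
      2 * (C * Real.sqrt ((n : ℝ) * Real.log ((m : ℝ) / (n : ℝ) + 2)))) :
    wS S ≤ ∫ g, FF (Gamma m n A C) g ∂(γ n) := by
  have hcube : InCube (Gamma m n A C) := fun y hy => hy.1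
  have hmem : ∀ z ∈ S, ∀ z' ∈ S, (fun j => (sg (z j) - sg (z' j)) / 2) ∈ Gamma m n A C := by
    intro z hz z' hz'
    refine ⟨fun j => ?_, fun i => ?_⟩
    · have h1 := abs_le.1 (sg_abs (z j))
      have h2 := abs_le.1 (sg_abs (z' j))
      rw [abs_le]; constructor <;> linarith [h1.1, h1.2, h2.1, h2.2]
    · have e : A.mulVec (fun j => (sg (z j) - sg (z' j)) / 2) i =
          ((∑ j, A i j * sg (z j)) - ∑ j, A i j * sg (z' j)) / 2 := by
        rw [← Finset.sum_sub_distrib, Finset.sum_div]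
        simp only [Matrix.mulVec, dotProduct]
        refine Finset.sum_congr rfl fun j _ => ?_
        ring
      rw [e, abs_div, abs_two]
      have := h z hz z' hz' i
      linarith
  have hne : (Gamma m n A C).Nonempty := by
    obtain ⟨z, hz⟩ := hS
    exact ⟨_, hmem z hz z hz⟩
  have pt : ∀ g, FF (KS S) g + FF (KS S) (-g) ≤ 2 * FF (Gamma m n A C) g := by
    intro g
    have : FF (KS S) g ≤ 2 * FF (Gamma m n A C) g - FF (KS S) (-g) := by
      refine FF_le (KS_ne hS) ?_
      rintro y ⟨z, hz, rfl⟩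
      have : FF (KS S) (-g) ≤ 2 * FF (Gamma m n A C) g - ∑ j, g j * sg (z j) := by
        refine FF_le (KS_ne hS) ?_
        rintro y ⟨z', hz', rfl⟩
        have h1 := le_FF hcube (hmem z hz z' hz') g
        have e : ∑ j, g j * ((sg (z j) - sg (z' j)) / 2) =
            (∑ j, g j * sg (z j) + ∑ j, (-g) j * sg (z' j)) / 2 := by
          rw [← Finset.sum_add_distrib, Finset.sum_div]
          refine Finset.sum_congr rfl fun j _ => ?_
          simp only [Pi.neg_apply]
          ring
        rw [e] at h1
        linarith
      linarith
    linarith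
  have i1 := FF_int (KS_cube S) (KS_ne hS)
  have i2 : Integrable (fun g => FF (KS S) (-g)) (γ n) := (neg_mp n).integrable_comp_of_integrable i1
  have := integral_mono (i1.add i2) ((FF_int hcube hne).const_mul 2) pt
  simp only [Pi.add_apply] at this
  rw [integral_add i1 i2, neg_invn (FF (KS S)), integral_const_mul] at this
  have e : wS S = ∫ g, FF (KS S) g ∂(γ n) := rfl
  linarith

lemma find_S {a C δ : ℝ} (hδ : 0 < δ) (ha : a = 1 + 2 * (8 / δ)) (hC0 : 0 < C)
    (hC : C ^ 2 = 8 * (2 + 2 * (4 * a / δ))) {m n : ℕ} (hn : 0 < n)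
    (A : Matrix (Fin m) (Fin n) ℝ) (hA : ∀ i j, |A i j| ≤ 1) :
    ∃ S : Finset (Fin n → Bool), S.Nonempty ∧ n * Real.log 2 - δ * n ≤ Real.log S.card ∧
      ∀ z ∈ S, ∀ z' ∈ S, ∀ i, |(∑ j, A i j * sg (z j)) - ∑ j, A i j * sg (z' j)| ≤
      2 * (C * Real.sqrt ((n : ℝ) * Real.log ((m : ℝ) / (n : ℝ) + 2))) := by
  have hn' : (0 : ℝ) < n := by exact_mod_cast hn
  have ha1 : 1 ≤ a := by
    have : 0 < 8 / δ := by positivity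
    linarith
  set w : ℝ := (m : ℝ) / n + 2 with hw
  have hw2 : 2 ≤ w := by
    have : 0 ≤ (m : ℝ) / n := by positivity
    linarith
  set L := Real.log w with hL
  have hLh : 1 / 2 ≤ L := by
    have h1 := Real.log_le_log (by norm_num) hw2
    have := Real.log_two_gt_d9
    linarith
  have hL0 : 0 < L := by linarith
  have hexpL : Real.exp L = w := Real.exp_log (by linarith)
  have hm : (m : ℝ) ≤ n * Real.exp L := by
    rw [hexpL, hw, mul_add, mul_div_cancel₀ _ hn'.ne']
    linarith
  have hLexp : L ≤ Real.exp L := by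
    have := Real.add_one_le_exp L
    linarith
  have hCL : 4 ≤ C ^ 2 * L := by
    have : 0 < 4 * a / δ := by positivity
    nlinarith
  have hs : Real.exp (-(a * L)) ≤ 1 / 2 := by
    have h1 : Real.exp (-(a * L)) ≤ Real.exp (-L) := by
      apply Real.exp_le_exp.2
      nlinarith
    have h2 : Real.exp (-L) ≤ 1 / 2 := by
      rw [Real.exp_neg, hexpL, one_div]
      exact inv_anti₀ (by norm_num) hw2
    linarith
  set T := C * Real.sqrt (n * L) with hT
  have hT0 : 0 < T := by positivity
  obtain ⟨v, hne, hlog⟩ := cell (X := Fin n → Bool)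
    (fun z i => round ((∑ j, A i j * sg (z j)) / T)) hs
  refine ⟨_, hne, ?_, ?_⟩
  · refine le_trans ?_ hlog
    have hcard : ((Fintype.card (Fin n → Bool) : ℕ) : ℝ) = 2 ^ n := by simp
    rw [hcard, Real.log_pow]
    have b1 : 4 * m * Real.exp (-(a * L)) ≤ δ / 2 * n := by
      have h1 : 4 * Real.exp (-((a - 1) * L)) ≤ δ / 2 := by
        refine exp_small (by norm_num) (by positivity) ?_
        have : 4 / (δ / 2) = (a - 1) * (1 / 2) := by rw [ha]; field_simp; ring
        rw [this]
        gcongr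
      calc 4 * m * Real.exp (-(a * L)) ≤ 4 * (n * Real.exp L) * Real.exp (-(a * L)) := by gcongr
        _ = 4 * (Real.exp L * Real.exp (-(a * L))) * n := by ring
        _ = 4 * Real.exp (-((a - 1) * L)) * n := by rw [← Real.exp_add]; ring_nf
        _ ≤ _ := by gcongr
    have b2 : a * L * (∑ z : Fin n → Bool, ∑ i : Fin m,
        |((round ((∑ j, A i j * sg (z j)) / T) : ℤ) : ℝ)|) / 2 ^ n ≤ δ / 2 * n := by
      have h0 : (∑ z : Fin n → Bool, ∑ i : Fin m,
        |((round ((∑ j, A i j * sg (z j)) / T) : ℤ) : ℝ)|) ≤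
          m * (2 ^ n * (2 * Real.exp (- (C ^ 2 * L / 8)))) := by
        rw [Finset.sum_comm]
        calc _ ≤ ∑ i : Fin m, (2 ^ n * (2 * Real.exp (- (C ^ 2 * L / 8)))) :=
              Finset.sum_le_sum fun i _ => avg_bd hn (A i) (hA i) hC0 hL0 hCL
          _ = _ := by simp
      have h1 : 2 * a * Real.exp (-((C ^ 2 / 8 - 2) * L)) ≤ δ / 2 := by
        refine exp_small (by positivity) (by positivity) ?_
        have : 2 * a / (δ / 2) = (C ^ 2 / 8 - 2) * (1 / 2) := by rw [hC]; field_simp; ring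
        rw [this]
        have : 0 < 4 * a / δ := by positivity
        gcongr
        linarith
      rw [div_le_iff₀ (by positivity)]
      calc _ ≤ a * L * (m * (2 ^ n * (2 * Real.exp (- (C ^ 2 * L / 8))))) := by gcongr
        _ ≤ a * Real.exp L * ((n * Real.exp L) * (2 ^ n * (2 * Real.exp (- (C ^ 2 * L / 8))))) := by
            gcongr
        _ = 2 * a * (Real.exp L * Real.exp L * Real.exp (- (C ^ 2 * L / 8))) * n * 2 ^ n := by ring
        _ = 2 * a * Real.exp (-((C ^ 2 / 8 - 2) * L)) * n * 2 ^ n := by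
            rw [← Real.exp_add, ← Real.exp_add]; ring_nf
        _ ≤ _ := by gcongr
    linarith
  · intro z hz z' hz' i
    have e1 := congrFun (Finset.mem_filter.1 hz).2 i
    have e2 := congrFun (Finset.mem_filter.1 hz').2 i
    have r1 := abs_sub_round ((∑ j, A i j * sg (z j)) / T)
    have r2 := abs_sub_round ((∑ j, A i j * sg (z' j)) / T)
    rw [e1, abs_le] at r1
    rw [e2, abs_le] at r2
    have : |(∑ j, A i j * sg (z j)) / T - (∑ j, A i j * sg (z' j)) / T| ≤ 2 := by
      rw [abs_le]; constructor <;> linarith [r1.1, r1.2, r2.1, r2.2]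
    rw [← sub_div, abs_div, abs_of_pos hT0, div_le_iff₀ hT0] at this
    exact this

/-- For large `C`, the trivial bound is nearly sharp:
`OPT_A(C) ≥ √(2n/π) - ε √n` for all large `n`. -/
theorem OPT_nearly_sharp :
    ∀ ε : ℝ, 0 < ε → ∃ C : ℝ, 0 < C ∧ ∃ n₀ : ℕ, ∀ n : ℕ, n₀ ≤ n → ∀ m : ℕ, 0 < m →
      ∀ A : Matrix (Fin m) (Fin n) ℝ, (∀ i j, |A i j| ≤ 1) →
        Real.sqrt (2 * n / Real.pi) - ε * Real.sqrt n ≤ OPT m n A C := by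
  intro ε hε
  set β := ε / 2 with hβ
  have hβ0 : 0 < β := by positivity
  set δ := β ^ 2 with hδ
  have hδ0 : 0 < δ := by positivity
  set a := 1 + 2 * (8 / δ) with ha
  have ha0 : 0 < a := by positivity
  refine ⟨Real.sqrt (8 * (2 + 2 * (4 * a / δ))), by positivity, 1, ?_⟩
  intro n hn m hm A hA
  have hn' : (0 : ℝ) < n := by exact_mod_cast hn
  obtain ⟨S, hS, hlog, hdiff⟩ := find_S hδ0 ha
    (C := Real.sqrt (8 * (2 + 2 * (4 * a / δ)))) (by positivity)
    (Real.sq_sqrt (by positivity)) hn A hA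
  have h1 := Gamma_ge A hS hdiff
  have h2 := width hβ0 n S hS
  have h3 := mul_le_mul_of_nonneg_left hlog (inv_pos.2 hβ0).le
  have h4 : β⁻¹ * (n * Real.log 2 - δ * n) = β⁻¹ * (n * Real.log 2) - β * n := by
    rw [hδ]; field_simp
  rw [h4] at h3
  have h5 : n * (Real.sqrt (2 / Real.pi) - ε) ≤
      ∫ g, FF (Gamma m n A (Real.sqrt (8 * (2 + 2 * (4 * a / δ))))) g ∂(γ n) := by
    have : ε = 2 * β := by rw [hβ]; ring
    rw [this]
    linarith
  have hsq : Real.sqrt n * Real.sqrt n = n := Real.mul_self_sqrt hn'.le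
  have hsn : 0 < Real.sqrt n := Real.sqrt_pos.2 hn'
  have h6 : Real.sqrt (2 * n / Real.pi) = Real.sqrt (2 / Real.pi) * Real.sqrt n := by
    rw [← Real.sqrt_mul (by positivity)]
    congr 1
    ring
  unfold OPT
  rw [le_div_iff₀ hsn, h6]
  refine le_trans (le_of_eq ?_) h5
  rw [← sub_mul, mul_assoc, hsq, mul_comm]
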